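/- Suppose m ≡ 22 (mod 24). Then j′, j″, j‴ ∈ J, P(j‴) ≠ 0, and for every j ∈ J with j ∉ {j′, j″, j‴}, either P(j) = 0 or V(j) < V(j‴). -/

import Mathlib

open Finset

/-- `s a` is the sum of the binary digits of `a`. -/
def sdig (a : ℕ) : ℕ := (Nat.digits 2 a).sum

/-- `carries a b` is the number of carries when adding `a` and `b` in base 2:
`c(a,b) = s(a) + s(b) - s(a+b)`. -/
def carries (a b : ℕ) : ℕ := sdig a + sdig b - sdig (a + b)

/-- The generalized binomial coefficient `C_r(x) = x(x-1)⋯(x-r+1)/r!` (with `C_0(x) = 1`). -/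
def genBinom (x : ℚ) (r : ℕ) : ℚ :=
  (∏ p ∈ Finset.range r, (x - p)) / (Nat.factorial r : ℚ)

/-- Membership in the index set `J`: here `j i` (for `i : Fin n`) is the paper's
`j_{i+1}`, so the defining relation `(2^n-1)j_1 + ⋯ + (2-1)j_n = m+1` becomes
`∑ k, (2^(n-k) - 1) * j k = m + 1`. -/
def inJ (n m : ℕ) (j : Fin n → ℕ) : Prop :=
  ∑ k : Fin n, (2 ^ (n - (k : ℕ)) - 1) * j k = m + 1

/-- `α_j(k)`: for `K : Fin n`, `alphaF n m j K` is the paper's `α_j(K+1)`, i.e.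
`m / 2^(n-K) - ∑_{I < K} 2^(K-I) j_{I+1}`. -/
def alphaF (n m : ℕ) (j : Fin n → ℕ) (K : Fin n) : ℚ :=
  (m : ℚ) / 2 ^ (n - (K : ℕ)) -
    ∑ I : Fin n, if (I : ℕ) < (K : ℕ) then 2 ^ ((K : ℕ) - (I : ℕ)) * (j I : ℚ) else 0

/-- `P(j) = ∏_{k=1}^n C_{j_k}(α_j(k))`. -/
def Pprod (n m : ℕ) (j : Fin n → ℕ) : ℚ :=
  ∏ k : Fin n, genBinom (alphaF n m j k) (j k)

/-- `V(j) = -ν(P(j))`, where `ν` is the 2-adic valuation on `ℚ`. -/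
def V (n m : ℕ) (j : Fin n → ℕ) : ℤ := - padicValRat 2 (Pprod n m j)

theorem sdig_two_mul (a : ℕ) : sdig (2 * a) = sdig a := by
  rcases Nat.eq_zero_or_pos a with rfl | h
  · simp
  · simp [sdig, h]

theorem sdig_two_mul_add_one (a : ℕ) : sdig (2 * a + 1) = sdig a + 1 := by
  have h := Nat.digits_add 2 (by norm_num) 1 a (by norm_num) (by simp)
  rw [sdig, add_comm, h, List.sum_cons, add_comm, sdig]

theorem sdig_zero : sdig 0 = 0 := by simp [sdig]

theorem sdig_one : sdig 1 = 1 := by simp [sdig]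

theorem two_mul_sdig_le (a : ℕ) : 2 * sdig a ≤ a + 1 := by
  suffices h : 2 * sdig a ≤ a + 1 ∧ sdig a ≤ a from h.1
  induction a using Nat.strong_induction_on with
  | _ a ih =>
    rcases Nat.even_or_odd' a with ⟨b, rfl | rfl⟩
    · rcases Nat.eq_zero_or_pos b with rfl | hb
      · simp [sdig_zero]
      · have := ih b (by omega)
        rw [sdig_two_mul]
        omega
    · have := ih b (by omega)
      rw [sdig_two_mul_add_one]
      omega

theorem sdig_pos {a : ℕ} (ha : 0 < a) : 0 < sdig a := by
  induction a using Nat.strong_induction_on with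
  | _ a ih =>
    rcases Nat.even_or_odd' a with ⟨b, rfl | rfl⟩
    · rw [sdig_two_mul]
      exact ih b (by omega) (by omega)
    · rw [sdig_two_mul_add_one]
      omega

theorem sdig_succ_le (a : ℕ) : sdig (a + 1) ≤ sdig a + 1 := by
  induction a using Nat.strong_induction_on with
  | _ a ih =>
    rcases Nat.even_or_odd' a with ⟨b, rfl | rfl⟩
    · rw [sdig_two_mul_add_one, sdig_two_mul]
    · have := ih b (by omega)
      rw [show 2 * b + 1 + 1 = 2 * (b + 1) by ring, sdig_two_mul, sdig_two_mul_add_one]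
      omega

theorem sdig_add_le (a b : ℕ) : sdig (a + b) ≤ sdig a + sdig b := by
  induction a using Nat.strong_induction_on generalizing b with
  | _ a ih =>
    rcases Nat.even_or_odd' a with ⟨c, rfl | rfl⟩ <;> rcases Nat.even_or_odd' b with ⟨d, rfl | rfl⟩
    · rcases Nat.eq_zero_or_pos c with rfl | hc
      · simp
      · rw [← mul_add]
        simpa only [sdig_two_mul] using ih c (by omega) d
    · rcases Nat.eq_zero_or_pos c with rfl | hc
      · simp
      · rw [← add_assoc, ← mul_add]
        have := ih c (by omega) d
        simp only [sdig_two_mul, sdig_two_mul_add_one]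
        omega
    · rw [show 2 * c + 1 + 2 * d = 2 * (c + d) + 1 by ring]
      have := ih c (by omega) d
      simp only [sdig_two_mul, sdig_two_mul_add_one]
      omega
    · rw [show 2 * c + 1 + (2 * d + 1) = 2 * (c + d + 1) by ring]
      have := ih c (by omega) d
      have := sdig_succ_le (c + d)
      simp only [sdig_two_mul, sdig_two_mul_add_one]
      omega

theorem padicValRat_odd_div_two_pow {z : ℤ} (hz : ¬ 2 ∣ z) (e : ℕ) :
    padicValRat 2 ((z : ℚ) / 2 ^ e) = -(e : ℤ) := by
  have hz0 : (z : ℚ) ≠ 0 := by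
    rintro h
    exact hz (by simp [Int.cast_eq_zero.mp h])
  rw [padicValRat.div hz0 (by positivity), padicValRat.of_int, padicValInt.eq_zero_of_not_dvd hz,
    padicValRat.pow]
  have : padicValRat 2 (2 : ℚ) = 1 := padicValRat.self (by norm_num)
  simp [this]

theorem padicValRat_finset_prod {ι : Type*} (s : Finset ι) (f : ι → ℚ) (p : ℕ) [Fact p.Prime]
    (hf : ∀ i ∈ s, f i ≠ 0) :
    padicValRat p (∏ i ∈ s, f i) = ∑ i ∈ s, padicValRat p (f i) := by
  classical
  induction s using Finset.induction_on with
  | empty => simp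
  | insert a s ha ih =>
    rw [prod_insert ha, sum_insert ha,
      padicValRat.mul (hf a (mem_insert_self a s))
        (prod_ne_zero_iff.mpr fun i hi => hf i (mem_insert_of_mem hi)),
      ih fun i hi => hf i (mem_insert_of_mem hi)]

theorem genBinom_odd_div_two_pow {z : ℤ} (hz : ¬ 2 ∣ z) {e : ℕ} (he : 1 ≤ e) (r : ℕ) :
    genBinom ((z : ℚ) / 2 ^ e) r ≠ 0 ∧
      padicValRat 2 (genBinom ((z : ℚ) / 2 ^ e) r) = -((e + 1 : ℤ) * r - sdig r) := by
  have hsub (p : ℕ) : (z : ℚ) / 2 ^ e - p = ((z - 2 ^ e * p : ℤ) : ℚ) / 2 ^ e := by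
    push_cast
    field_simp
  have hodd (p : ℕ) : ¬ (2 : ℤ) ∣ z - 2 ^ e * p := by
    have h2 : (2 : ℤ) ∣ 2 ^ e * p := (dvd_pow_self 2 (by omega)).mul_right _
    rwa [← dvd_sub_comm, dvd_sub_right h2]
  have hne (p : ℕ) : (z : ℚ) / 2 ^ e - p ≠ 0 := by
    rw [hsub]
    refine div_ne_zero (Int.cast_ne_zero.mpr fun h => hodd p (by simp [h])) (by positivity)
  have hprod : ∏ p ∈ range r, ((z : ℚ) / 2 ^ e - p) ≠ 0 := prod_ne_zero_iff.mpr fun p _ => hne p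
  have hfac : (r.factorial : ℚ) ≠ 0 := by positivity
  refine ⟨div_ne_zero hprod hfac, ?_⟩
  rw [genBinom, padicValRat.div hprod hfac, padicValRat_finset_prod _ _ _ fun p _ => hne p]
  simp_rw [hsub, padicValRat_odd_div_two_pow (hodd _)]
  have h1 := sub_one_mul_padicValNat_factorial (p := 2) r
  have h2 := Nat.digit_sum_le 2 r
  rw [padicValRat.of_nat, sum_const, card_range, nsmul_eq_mul, sdig]
  have h3 : (padicValNat 2 r.factorial : ℤ) = r - (Nat.digits 2 r).sum := by omega
  rw [h3]
  ring

theorem padicValRat_genBinom_intCast_nonneg (a : ℤ) (r : ℕ) :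
    0 ≤ padicValRat 2 (genBinom a r) := by
  have h : genBinom a r = ((Ring.choose a r : ℤ) : ℚ) := by
    have h1 := Ring.descPochhammer_eq_factorial_smul_choose a r
    rw [← Polynomial.eval_eq_smeval, descPochhammer_eval_eq_prod_range,
      nsmul_eq_mul] at h1
    rw [genBinom, div_eq_iff (by positivity), mul_comm]
    exact_mod_cast h1
  rw [h, padicValRat.of_int]
  positivity

/-- The integer subtracted from `m / 2 ^ (n - K)` in `alphaF n m j K`. -/
def alphaShift (n : ℕ) (j : Fin n → ℕ) (K : Fin n) : ℤ :=
  ∑ I : Fin n, if (I : ℕ) < (K : ℕ) then 2 ^ ((K : ℕ) - (I : ℕ)) * (j I : ℤ) else 0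

theorem alphaF_eq (n m : ℕ) (j : Fin n → ℕ) (K : Fin n) :
    alphaF n m j K = (m : ℚ) / 2 ^ (n - (K : ℕ)) - alphaShift n j K := by
  simp [alphaF, alphaShift]

theorem genBinom_alphaF {n m q : ℕ} (hm : m = 2 * q) (hq : q % 2 = 1) (j : Fin n → ℕ) (K : Fin n)
    (hK : (K : ℕ) + 1 < n) :
    genBinom (alphaF n m j K) (j K) ≠ 0 ∧
      padicValRat 2 (genBinom (alphaF n m j K) (j K)) =
        -((n - (K : ℕ) : ℤ) * j K - sdig (j K)) := by
  obtain ⟨e, he⟩ : ∃ e, n - (K : ℕ) = e + 2 := ⟨n - K - 2, by omega⟩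
  have hα : alphaF n m j K = ((q - 2 ^ (e + 1) * alphaShift n j K : ℤ) : ℚ) / 2 ^ (e + 1) := by
    rw [alphaF_eq, he, hm]
    push_cast
    field_simp
    ring
  have hodd : ¬ (2 : ℤ) ∣ q - 2 ^ (e + 1) * alphaShift n j K := by
    rw [pow_succ, mul_right_comm]
    omega
  have hn : (n - (K : ℕ) : ℤ) = (e + 1 : ℕ) + 1 := by omega
  rw [hα, hn]
  exact genBinom_odd_div_two_pow hodd (by omega) _

theorem V_eq {n m q : ℕ} (hm : m = 2 * q) (hq : q % 2 = 1) (j : Fin (n + 1) → ℕ)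
    (hlast : genBinom (alphaF (n + 1) m j (Fin.last n)) (j (Fin.last n)) ≠ 0) :
    Pprod (n + 1) m j ≠ 0 ∧ V (n + 1) m j =
      ∑ K : Fin n, ((n + 1 - (K : ℕ) : ℤ) * j K.castSucc - sdig (j K.castSucc)) -
        padicValRat 2 (genBinom (alphaF (n + 1) m j (Fin.last n)) (j (Fin.last n))) := by
  have h (K : Fin n) := genBinom_alphaF hm hq j K.castSucc (by simp)
  have hprod : ∏ K : Fin n, genBinom (alphaF (n + 1) m j K.castSucc) (j K.castSucc) ≠ 0 :=
    prod_ne_zero_iff.mpr fun K _ => (h K).1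
  refine ⟨?_, ?_⟩
  · rw [Pprod, Fin.prod_univ_castSucc]
    exact mul_ne_zero hprod hlast
  · rw [V, Pprod, Fin.prod_univ_castSucc, padicValRat.mul hprod hlast,
      padicValRat_finset_prod _ _ _ fun K _ => (h K).1]
    simp_rw [fun K => (h K).2]
    rw [sum_neg_distrib]
    push_cast
    simp only [Fin.val_castSucc]
    ring

theorem V_le {n m q : ℕ} (hm : m = 2 * q) (hq : q % 2 = 1) (j : Fin (n + 1) → ℕ)
    (hP : Pprod (n + 1) m j ≠ 0) :
    V (n + 1) m j ≤
      ∑ K : Fin n, ((n + 1 - (K : ℕ) : ℤ) * j K.castSucc - sdig (j K.castSucc)) := by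
  have hlast : genBinom (alphaF (n + 1) m j (Fin.last n)) (j (Fin.last n)) ≠ 0 :=
    prod_ne_zero_iff.mp hP _ (mem_univ _)
  have hα : alphaF (n + 1) m j (Fin.last n) =
      ((q - alphaShift (n + 1) j (Fin.last n) : ℤ) : ℚ) := by
    rw [alphaF_eq, hm]
    simp
  rw [(V_eq hm hq j hlast).2, hα]
  have := padicValRat_genBinom_intCast_nonneg (q - alphaShift (n + 1) j (Fin.last n))
    (j (Fin.last n))
  linarith

theorem two_mul_add_eight_le_two_pow {e : ℕ} (he : 4 ≤ e) : 2 * e + 8 ≤ 2 ^ e := by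
  induction e, he using Nat.le_induction with
  | base => norm_num
  | succ e he ih => rw [pow_succ]; omega

theorem weight_bound {e : ℕ} (he : 4 ≤ e) (x : ℕ) :
    2 * ((e : ℤ) * x - sdig x) + 9 * (if x = 0 then 0 else 1) ≤ ((2 ^ e - 1) * x : ℕ) := by
  have h := two_mul_add_eight_le_two_pow he
  split_ifs with hx
  · simp [hx, sdig_zero]
  · have hs := sdig_pos (Nat.pos_of_ne_zero hx)
    have h2 : (2 * e + 7) * x ≤ (2 ^ e - 1) * x := Nat.mul_le_mul_right x (by omega)
    have h3 : (2 * e + 7) * x = 2 * (e * x) + 7 * x := by ring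
    have h4 : ((e * x : ℕ) : ℤ) = e * x := by push_cast; rfl
    omega

theorem weight_sum_bound (N : ℕ) (x : Fin N → ℕ) :
    x = 0 ∨ 2 * ∑ i : Fin N, ((N + 3 - (i : ℕ) : ℤ) * x i - sdig (x i)) + 9 ≤
      (∑ i : Fin N, (2 ^ (N + 3 - (i : ℕ)) - 1) * x i : ℕ) := by
  refine or_iff_not_imp_left.mpr fun hx => ?_
  obtain ⟨i, hi⟩ := Function.ne_iff.mp hx
  have h1 (i : Fin N) := weight_bound (e := N + 3 - (i : ℕ)) (by omega) (x i)
  have h2 : (1 : ℤ) ≤ ∑ i : Fin N, if x i = 0 then 0 else 1 := by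
    have := single_le_sum (f := fun i => if x i = 0 then (0 : ℤ) else 1)
      (fun i _ => by positivity) (mem_univ i)
    simpa [show x i ≠ 0 from hi] using this
  have h3 := sum_le_sum fun i (_ : i ∈ (univ : Finset (Fin N))) => h1 i
  rw [sum_add_distrib, ← mul_sum, ← mul_sum, ← Nat.cast_sum] at h3
  have h4 (i : Fin N) : ((N + 3 - (i : ℕ) : ℕ) : ℤ) = N + 3 - (i : ℕ) := by omega
  simp only [h4] at h3
  linarith

theorem digit_sum_bound {U : ℤ} {W A x0 x1 x2 : ℕ} (hsum : W + 7 * x2 + 3 * x1 + x0 = 3 * A + 2)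
    (hWU : W = 0 ∧ U = 0 ∧ ¬ (x2 = 0 ∧ x0 = 2) ∧ ¬ (x2 = 0 ∧ x0 = 5) ∧ ¬ (x2 = 1 ∧ x0 = 1) ∨
      2 * U + 9 ≤ W) :
    U + (3 * x2 - sdig x2) + (2 * x1 - sdig x1) ≤ 2 * A - sdig A - 2 := by
  obtain ⟨T, rfl⟩ : ∃ T, A = x1 + T := Nat.exists_eq_add_of_le (by omega)
  have hA := sdig_add_le x1 T
  have hT := two_mul_sdig_le T
  have s0 := sdig_zero
  have s1 := sdig_one
  have s2 := sdig_two_mul 1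
  have s4 := sdig_two_mul 2
  have s3 := sdig_two_mul_add_one 1
  norm_num at s2 s3 s4
  by_cases hx : x2 < 5
  · by_cases h4 : T = 4
    · subst h4
      interval_cases x2 <;> omega
    · interval_cases x2 <;> omega
  · have := sdig_pos (a := x2) (by omega)
    omega

/-- If `m ≡ 22 mod 24`, then `j', j'', j‴ ∈ J`, `P(j‴) ≠ 0`, and every
`j ∈ J` outside `{j', j'', j‴}` has `P(j) = 0` or `V(j) < V(j‴)`. -/
theorem stmt13 (n m : ℕ) (hn : 3 ≤ n) (hm : 1 ≤ m) (hmn : m ≤ 2 ^ (n + 1) - 3)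
    (h24 : m % 24 = 22)
    (j1 : Fin n → ℕ)
    (hj1 : j1 = fun k : Fin n =>
      if (k : ℕ) = n - 2 then (m - 1) / 3 else if (k : ℕ) = n - 1 then 2 else 0)
    (j2 : Fin n → ℕ)
    (hj2 : j2 = fun k : Fin n =>
      if (k : ℕ) = n - 2 then (m - 4) / 3 else if (k : ℕ) = n - 1 then 5 else 0)
    (j3 : Fin n → ℕ)
    (hj3 : j3 = fun k : Fin n =>
      if (k : ℕ) = n - 3 then 1
      else if (k : ℕ) = n - 2 then (m - 7) / 3
      else if (k : ℕ) = n - 1 then 1 else 0) :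
    inJ n m j1 ∧ inJ n m j2 ∧ inJ n m j3 ∧ Pprod n m j3 ≠ 0 ∧
      ∀ j : Fin n → ℕ, inJ n m j → j ≠ j1 → j ≠ j2 → j ≠ j3 →
        Pprod n m j = 0 ∨ V n m j < V n m j3 := by
  obtain ⟨N, rfl⟩ : ∃ N, n = N + 3 := ⟨n - 3, by omega⟩
  obtain ⟨B, rfl⟩ : ∃ B, m = 24 * B + 22 := ⟨m / 24, by omega⟩
  have d1 : (24 * B + 22 - 1) / 3 = 8 * B + 7 := by omega
  have d2 : (24 * B + 22 - 4) / 3 = 8 * B + 6 := by omega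
  have d3 : (24 * B + 22 - 7) / 3 = 8 * B + 5 := by omega
  rw [d1] at hj1
  rw [d2] at hj2
  rw [d3] at hj3
  have hlt (i : Fin N) : (i : ℕ) ≠ N ∧ (i : ℕ) ≠ N + 1 ∧ (i : ℕ) ≠ N + 2 := by
    have := i.isLt
    omega
  have hα : alphaF (N + 3) (24 * B + 22) j3 (Fin.last (N + 2)) = ((-(4 * B + 3) : ℤ) : ℚ) := by
    subst hj3
    simp [alphaF, Fin.sum_univ_castSucc, hlt]
    ring
  have hg : genBinom (alphaF (N + 3) (24 * B + 22) j3 (Fin.last (N + 2))) (j3 (Fin.last (N + 2)))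
      = ((-(4 * B + 3) : ℤ) : ℚ) := by
    rw [hα, hj3]
    simp [genBinom]
  have hV3 := V_eq (m := 24 * B + 22) (q := 12 * B + 11) (by ring) (by omega) j3
    (by rw [hg]; exact Int.cast_ne_zero.mpr (by omega))
  refine ⟨?_, ?_, ?_, hV3.1, ?_⟩
  · subst hj1
    simp [inJ, Fin.sum_univ_castSucc, hlt]
    ring
  · subst hj2
    simp [inJ, Fin.sum_univ_castSucc, hlt]
    ring
  · subst hj3
    simp [inJ, Fin.sum_univ_castSucc, hlt]
    ring
  intro j hj hne1 hne2 hne3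
  refine or_iff_not_imp_left.mpr fun hP => ?_
  refine (V_le (q := 12 * B + 11) (by ring) (by omega) j hP).trans_lt ?_
  rw [hV3.2, hg, padicValRat.of_int, padicValInt.eq_zero_of_not_dvd (by omega)]
  have hval : ∑ K : Fin (N + 2), ((((N + 2 : ℕ) : ℤ) + 1 - (K : ℕ)) * j3 K.castSucc -
      sdig (j3 K.castSucc)) = 16 * B + 12 - sdig (8 * B + 5) := by
    simp [hj3, Fin.sum_univ_castSucc, hlt, sdig_zero, sdig_one]
    ring
  have h5 : sdig (8 * B + 5) = sdig B + 2 := by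
    rw [show 8 * B + 5 = 2 * (2 * (2 * B + 1)) + 1 by ring]
    simp only [sdig_two_mul, sdig_two_mul_add_one]
  have h7 : sdig (8 * B + 7) = sdig B + 3 := by
    rw [show 8 * B + 7 = 2 * (2 * (2 * B + 1) + 1) + 1 by ring]
    simp only [sdig_two_mul_add_one]
  rw [hval]
  have hJ : ∑ i : Fin N, (2 ^ (N + 3 - (i : ℕ)) - 1) * j i.castSucc.castSucc.castSucc +
      7 * j (Fin.last N).castSucc.castSucc + 3 * j (Fin.last (N + 1)).castSucc +
      j (Fin.last (N + 2)) = 3 * (8 * B + 7) + 2 := by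
    simp [inJ, Fin.sum_univ_castSucc] at hj
    omega
  have hext (j' : Fin (N + 3) → ℕ)
      (h : ∀ i : Fin N, j i.castSucc.castSucc.castSucc = j' i.castSucc.castSucc.castSucc)
      (h2 : j (Fin.last N).castSucc.castSucc = j' (Fin.last N).castSucc.castSucc)
      (h1 : j (Fin.last (N + 1)).castSucc = j' (Fin.last (N + 1)).castSucc)
      (h0 : j (Fin.last (N + 2)) = j' (Fin.last (N + 2))) : j = j' :=
    funext fun K => K.lastCases h0 fun K => K.lastCases h1 fun K => K.lastCases h2 h
  have hbound := digit_sum_bound hJ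
    (U := ∑ i : Fin N, ((N + 3 - (i : ℕ) : ℤ) * j i.castSucc.castSucc.castSucc
      - sdig (j i.castSucc.castSucc.castSucc))) <| by
    refine (weight_sum_bound N fun i => j i.castSucc.castSucc.castSucc).imp_left fun hx => ?_
    have hx (i : Fin N) : j i.castSucc.castSucc.castSucc = 0 := congrFun hx i
    simp only [hx, mul_zero, sum_const_zero, zero_add] at hJ
    refine ⟨by simp [hx], by simp [hx, sdig_zero], fun h => hne1 ?_, fun h => hne2 ?_,
      fun h => hne3 ?_⟩
    · apply hext <;> simp [hj1, hlt, hx] <;> omega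
    · apply hext <;> simp [hj2, hlt, hx] <;> omega
    · apply hext <;> simp [hj3, hlt, hx] <;> omega
  have hsplit : ∑ K : Fin (N + 2), ((((N + 2 : ℕ) : ℤ) + 1 - (K : ℕ)) * j K.castSucc -
      sdig (j K.castSucc)) =
      ∑ i : Fin N, ((N + 3 - (i : ℕ) : ℤ) * j i.castSucc.castSucc.castSucc
        - sdig (j i.castSucc.castSucc.castSucc)) +
      (3 * j (Fin.last N).castSucc.castSucc - sdig (j (Fin.last N).castSucc.castSucc)) +
      (2 * j (Fin.last (N + 1)).castSucc - sdig (j (Fin.last (N + 1)).castSucc)) := by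
    rw [Fin.sum_univ_castSucc, Fin.sum_univ_castSucc]
    simp only [Fin.val_castSucc, Fin.val_last]
    push_cast
    ring_nf
  rw [hsplit]
  omega
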